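/- arXiv:1701.05129 — 9 statements merged into one kernel-verified Lean document; each statement's English description precedes it below -/
import Mathlib

section
/- Let s : ℕ → ℝ be a sequence with s(0) = 1, such that s(k) > s(k-1) for all 1 ≤ k ≤ r, and such that for every k with 3 ≤ k ≤ r the inequality (s(k) - s(k-2))·(s(k-2) - s(k-3)) ≥ (s(k-1) - s(k-3))·(s(k-1) - s(k-2)) holds. Then for every r ≥ 3 one has s(r) ≥ (s(2) - s(1))^(r-1) / (s(1) - 1)^(r-2). -/
theorem stmt_0 (r : ℕ) (hr : 3 ≤ r) (s : ℕ → ℝ) (h0 : s 0 = 1)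
    (hmono : ∀ k, 1 ≤ k → k ≤ r → s k > s (k - 1))
    (hineq : ∀ k, 3 ≤ k → k ≤ r →
      (s k - s (k - 2)) * (s (k - 2) - s (k - 3)) ≥
        (s (k - 1) - s (k - 3)) * (s (k - 1) - s (k - 2))) :
    s r ≥ (s 2 - s 1) ^ (r - 1) / (s 1 - 1) ^ (r - 2) := by
  have ha : 0 < s 1 - 1 := by
    have := hmono 1 le_rfl (by omega)
    simp only [Nat.sub_self, h0] at this
    linarith
  have hb : 0 < s 2 - s 1 := by
    have := hmono 2 (by omega) (by omega)
    simp only [Nat.add_one_sub_one] at this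
    linarith
  have key : ∀ n, n + 2 ≤ r → 1 ≤ s (n + 1) ∧
      (s (n + 1) - s n) * (s 2 - s 1) ≤ (s (n + 2) - s (n + 1)) * (s 1 - 1) ∧
      (s 2 - s 1) ^ (n + 1) ≤ (s (n + 2) - s (n + 1)) * (s 1 - 1) ^ n := by
    intro n
    induction n with
    | zero =>
      intro _
      refine ⟨by simp; linarith, ?_, by simp⟩
      simp only [zero_add, h0]
      linarith [mul_comm (s 1 - 1) (s 2 - s 1)]
    | succ n ih =>
      intro hn
      obtain ⟨h1, h2, h3⟩ := ih (by omega)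
      have e1 : s (n + 1) > s n := hmono (n + 1) (by omega) (by omega)
      have e2 : s (n + 2) > s (n + 1) := hmono (n + 2) (by omega) (by omega)
      have e3 : (s (n + 3) - s (n + 1)) * (s (n + 1) - s n) ≥
        (s (n + 2) - s n) * (s (n + 2) - s (n + 1)) := hineq (n + 3) (by omega) (by omega)
      have h4 : (s (n + 2) - s (n + 1)) * (s 2 - s 1) ≤
          (s (n + 3) - s (n + 2)) * (s 1 - 1) := by
        have p1 : 0 < s (n + 1) - s n := by linarith
        have p2 : 0 < s (n + 2) - s (n + 1) := by linarith
        refine le_of_mul_le_mul_right ?_ p1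
        have q1 := mul_le_mul_of_nonneg_left h2 p2.le
        have q2 := mul_le_mul_of_nonneg_right e3 ha.le
        linarith
      refine ⟨by linarith, h4, ?_⟩
      calc (s 2 - s 1) ^ (n + 1 + 1) = (s 2 - s 1) ^ (n + 1) * (s 2 - s 1) := pow_succ _ _
        _ ≤ ((s (n + 2) - s (n + 1)) * (s 1 - 1) ^ n) * (s 2 - s 1) :=
          mul_le_mul_of_nonneg_right h3 hb.le
        _ = ((s (n + 2) - s (n + 1)) * (s 2 - s 1)) * (s 1 - 1) ^ n := by ring
        _ ≤ ((s (n + 3) - s (n + 2)) * (s 1 - 1)) * (s 1 - 1) ^ n :=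
          mul_le_mul_of_nonneg_right h4 (pow_pos ha n).le
        _ = _ := by ring
  obtain ⟨m, rfl⟩ : ∃ m, r = m + 2 := ⟨r - 2, by omega⟩
  obtain ⟨h1, -, h3⟩ := key m le_rfl
  have p := pow_pos ha m
  change (s 2 - s 1) ^ (m + 1) / (s 1 - 1) ^ m ≤ s (m + 2)
  rw [div_le_iff₀ p]
  refine h3.trans (mul_le_mul_of_nonneg_right (by linarith) p.le)
end

section
/- Let s₁ ≥ 3 and α ≥ 2 be integers with α² ≥ s₁, and set φ = α² + s₁²(s₁-1)² - 2αs₁(s₁+1). Then φ² · (α - s₁(s₁-1))² · (α(2s₁-1) + s₁(s₁-1))² · (α + s₁(s₁-1))² < 4αs₁ · ((s₁-1)α + (s₁-1)²)^10. -/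
theorem stmt_2 (s₁ α : ℤ) (hs : 3 ≤ s₁) (hα : 2 ≤ α) (hα2 : α ^ 2 ≥ s₁)
    (φ : ℤ) (hφ : φ = α ^ 2 + s₁ ^ 2 * (s₁ - 1) ^ 2 - 2 * α * s₁ * (s₁ + 1)) :
    φ ^ 2 * (α - s₁ * (s₁ - 1)) ^ 2 * (α * (2 * s₁ - 1) + s₁ * (s₁ - 1)) ^ 2 *
        (α + s₁ * (s₁ - 1)) ^ 2 <
      4 * α * s₁ * ((s₁ - 1) * α + (s₁ - 1) ^ 2) ^ 10 := by
  obtain ⟨t, rfl⟩ : ∃ t, s₁ = t + 3 := ⟨s₁ - 3, by ring⟩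
  obtain ⟨a, rfl⟩ : ∃ a, α = a + 2 := ⟨α - 2, by ring⟩
  have ht : 0 ≤ t := by linarith
  have ha : 0 ≤ a := by linarith
  obtain ⟨M, hM⟩ : ∃ M, M = (t + 3 - 1) * (a + 2) + (t + 3 - 1) ^ 2 := ⟨_, rfl⟩
  have hM0 : 0 < M := by rw [hM]; ring_nf; positivity
  have h1 : φ ^ 2 ≤ (M ^ 2) ^ 2 := by
    apply sq_le_sq'
    · rw [← sub_nonneg, hφ, hM]
      ring_nf
      positivity
    · rw [← sub_nonneg, hφ, hM]
      ring_nf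
      positivity
  have hst : (t + 3) * (t + 3 - 1) ≤ M := by
    rw [← sub_nonneg, hM]; ring_nf; positivity
  have haM : a + 2 ≤ M := by
    rw [← sub_nonneg, hM]; ring_nf; positivity
  have hst0 : 0 ≤ (t + 3) * (t + 3 - 1) := by ring_nf; positivity
  have h2 : ((a + 2) ^ 2 - ((t + 3) * (t + 3 - 1)) ^ 2) ^ 2 ≤ (M ^ 2) ^ 2 := by
    have e1 := pow_le_pow_left₀ hst0 hst 2
    have e2 := pow_le_pow_left₀ (by linarith : 0 ≤ a + 2) haM 2
    apply sq_le_sq' <;> nlinarith [sq_nonneg (a + 2), sq_nonneg ((t + 3) * (t + 3 - 1))]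
  have h3 : ((a + 2) * (2 * (t + 3) - 1) + (t + 3) * (t + 3 - 1)) ^ 2 ≤ (3 * M) ^ 2 := by
    apply pow_le_pow_left₀
    · ring_nf; positivity
    · rw [← sub_nonneg, hM]; ring_nf; positivity
  have h4 : 9 < 4 * (a + 2) * (t + 3) := by nlinarith [mul_nonneg ha ht]
  rw [← hM]
  calc _ = φ ^ 2 * ((a + 2) ^ 2 - ((t + 3) * (t + 3 - 1)) ^ 2) ^ 2 *
        ((a + 2) * (2 * (t + 3) - 1) + (t + 3) * (t + 3 - 1)) ^ 2 := by ring
    _ ≤ (M ^ 2) ^ 2 * (M ^ 2) ^ 2 * (3 * M) ^ 2 := by gcongr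
    _ = 9 * M ^ 10 := by ring
    _ < _ := by gcongr
end

section
/- For every integer t ≥ 3, the number t⁶ - t⁴ + 1 is not a perfect square; that is, there is no integer a with a² = t⁶ - t⁴ + 1. -/
theorem stmt_4 (t : ℤ) (ht : 3 ≤ t) : ¬ ∃ a : ℤ, a ^ 2 = t ^ 6 - t ^ 4 + 1 := by
  rintro ⟨a, ha⟩
  have h2 : 9 ≤ t ^ 2 := by nlinarith
  have h3 : 3 * t ^ 2 ≤ t ^ 3 := by nlinarith [sq_nonneg t]
  have h4 : t ≤ t ^ 2 := by nlinarith
  have key : (2 * |a|) ^ 2 = (2 * t ^ 3 - t) ^ 2 - t ^ 2 + 4 := by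
    rw [mul_pow, sq_abs, ha]; ring
  have hpos : 0 ≤ 2 * t ^ 3 - t - 1 := by linarith
  have hup : 2 * |a| < 2 * t ^ 3 - t := by
    apply lt_of_pow_lt_pow_left₀ 2 (by linarith)
    linarith
  have hlow : 2 * t ^ 3 - t - 1 < 2 * |a| := by
    apply lt_of_pow_lt_pow_left₀ 2 (by positivity)
    have : (2 * t ^ 3 - t - 1) ^ 2 = (2 * t ^ 3 - t) ^ 2 - 2 * (2 * t ^ 3 - t) + 1 := by ring
    linarith
  omega
end

section
/- There are no integers t ≥ 3 and a ≥ 0 satisfying (2t³ - t + 2a)(2t³ - t - 2a) = t² - 4. -/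
theorem stmt_5 : ¬ ∃ t a : ℤ, 3 ≤ t ∧ 0 ≤ a ∧
    (2 * t ^ 3 - t + 2 * a) * (2 * t ^ 3 - t - 2 * a) = t ^ 2 - 4 := by
  rintro ⟨t, a, ht, ha, h⟩
  have h1 : t ^ 2 - 4 < 2 * t ^ 3 - t := by nlinarith [sq_nonneg t, mul_nonneg (sq_nonneg t) (by linarith : (0:ℤ) ≤ t - 3)]
  have h2 : 0 < t ^ 2 - 4 := by nlinarith
  have h3 : 0 < 2 * t ^ 3 - t + 2 * a := by linarith
  have h4 : 0 < 2 * t ^ 3 - t - 2 * a := by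
    rw [← h] at h2
    exact (mul_pos_iff_of_pos_left h3).mp h2
  have h5 : 1 ≤ 2 * t ^ 3 - t - 2 * a := h4
  have h6 := le_mul_of_one_le_right h3.le h5
  linarith
end

section
/- For every integer t ≥ 2, the number t⁶ + 2t⁵ + 2t⁴ - 2t² - 2t is not a perfect square; that is, there is no integer a with a² = t⁶ + 2t⁵ + 2t⁴ - 2t² - 2t. -/
theorem stmt_6 (t : ℤ) (ht : 2 ≤ t) :
    ¬ ∃ a : ℤ, a ^ 2 = t ^ 6 + 2 * t ^ 5 + 2 * t ^ 4 - 2 * t ^ 2 - 2 * t := by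
  rintro ⟨a, ha⟩
  obtain ⟨s, rfl⟩ : ∃ s, t = s + 2 := ⟨t - 2, by ring⟩
  have hs : 0 ≤ s := by linarith
  set P : ℤ := 2 * (s + 2) ^ 3 + 2 * (s + 2) ^ 2 + (s + 2) - 1 with hP
  have hP1 : 0 < P - 1 := by
    have : P - 1 = 2 * s ^ 3 + 14 * s ^ 2 + 33 * s + 24 := by rw [hP]; ring
    rw [this]; positivity
  have h4 : (2 * |a|) ^ 2 = P ^ 2 - (5 * (s + 2) ^ 2 + 6 * (s + 2) + 1) := by
    rw [mul_pow, sq_abs, ha, hP]; ring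
  have hlt : 2 * |a| < P := by
    apply lt_of_pow_lt_pow_left₀ 2 (by linarith)
    have : 0 < 5 * (s + 2) ^ 2 + 6 * (s + 2) + 1 := by positivity
    linarith
  have hgt : P - 1 < 2 * |a| := by
    apply lt_of_pow_lt_pow_left₀ 2 (by positivity)
    have : (2 * |a|) ^ 2 - (P - 1) ^ 2 = 4 * s ^ 3 + 23 * s ^ 2 + 40 * s + 16 := by
      rw [h4, hP]; ring
    have : 0 < 4 * s ^ 3 + 23 * s ^ 2 + 40 * s + 16 := by positivity
    linarith
  linarith [Int.add_one_le_iff.mpr hgt]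
end

section
/- For every integer t ≥ 2, the number t⁶ + 2t⁵ + 3t⁴ + t³ - t² - 3t - 2 is not a perfect square; that is, there is no integer a with a² = t⁶ + 2t⁵ + 3t⁴ + t³ - t² - 3t - 2. -/
theorem stmt_8 (t : ℤ) (ht : 2 ≤ t) :
    ¬ ∃ a : ℤ, a ^ 2 = t ^ 6 + 2 * t ^ 5 + 3 * t ^ 4 + t ^ 3 - t ^ 2 - 3 * t - 2 := by
  rintro ⟨a, ha⟩
  have h2 : 4 ≤ t ^ 2 := by nlinarith
  have h3 : 4 * t ≤ t ^ 3 := by nlinarith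
  have hlow : (t ^ 3 + t ^ 2 + t - 1) ^ 2 < a ^ 2 := by
    rw [ha]
    have : t ^ 6 + 2 * t ^ 5 + 3 * t ^ 4 + t ^ 3 - t ^ 2 - 3 * t - 2
      = (t ^ 3 + t ^ 2 + t - 1) ^ 2 + (t ^ 3 - t - 3) := by ring
    linarith
  have hup : a ^ 2 < (t ^ 3 + t ^ 2 + t) ^ 2 := by
    rw [ha]
    have : t ^ 6 + 2 * t ^ 5 + 3 * t ^ 4 + t ^ 3 - t ^ 2 - 3 * t - 2
      = (t ^ 3 + t ^ 2 + t) ^ 2 - (t ^ 3 + 2 * t ^ 2 + 3 * t + 2) := by ring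
    linarith
  have h4 := sq_lt_sq.mp hlow
  have h5 := sq_lt_sq.mp hup
  rw [abs_of_nonneg (by linarith : 0 ≤ t ^ 3 + t ^ 2 + t - 1)] at h4
  rw [abs_of_nonneg (by linarith : 0 ≤ t ^ 3 + t ^ 2 + t)] at h5
  linarith [Int.add_one_le_iff.mpr h4]
end

section
/- For every integer t ≥ 2, the number t¹² + 6t¹¹ + 17t¹⁰ + 26t⁹ + 17t⁸ - 12t⁷ - 35t⁶ - 28t⁵ - 4t⁴ + 8t³ + 4t² + 1 is not a perfect square; that is, there is no integer a whose square equals this value. -/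
theorem stmt_10 (t : ℤ) (ht : 2 ≤ t) :
    ¬ ∃ a : ℤ, a ^ 2 = t ^ 12 + 6 * t ^ 11 + 17 * t ^ 10 + 26 * t ^ 9 + 17 * t ^ 8 -
      12 * t ^ 7 - 35 * t ^ 6 - 28 * t ^ 5 - 4 * t ^ 4 + 8 * t ^ 3 + 4 * t ^ 2 + 1 := by
  rintro ⟨a, ha⟩
  obtain ⟨q, hq⟩ : ∃ q : ℤ, q = 2*t^6+6*t^5+8*t^4+2*t^3-5*t^2-5*t-1 := ⟨_, rfl⟩
  obtain ⟨R, hR⟩ : ∃ R : ℤ, R = -5*t^4-14*t^3-19*t^2-10*t+3 := ⟨_, rfl⟩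
  have h4 : (2*a)^2 = q^2 + R := by
    rw [hq, hR, mul_pow, ha]; ring
  have key : R < 0 ∧ 0 < 2*q + R - 1 ∧ 0 < q - 1 := by
    obtain ⟨s, rfl⟩ : ∃ s : ℤ, t = s + 2 := ⟨t - 2, by ring⟩
    have hs : 0 ≤ s := by linarith
    refine ⟨?_, ?_, ?_⟩
    · have : 0 < -R := by
        rw [hR]; ring_nf; positivity
      linarith
    · rw [hq, hR]; ring_nf; positivity
    · rw [hq]; ring_nf; positivity
  obtain ⟨h1, h2, h3⟩ := key
  have h5 : |2*a| < |q| := sq_lt_sq.mp (by linarith)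
  have h6 : |q - 1| < |2*a| := sq_lt_sq.mp (by nlinarith)
  rw [abs_of_pos h3] at h6
  rw [abs_of_pos (by linarith : 0 < q)] at h5
  omega
end

section
/- There are no integers t ≥ 2 and a ≥ 0 satisfying (2t⁶ + 6t⁵ + 8t⁴ + 2t³ - 5t² - 5t - 1 + 2a)(2t⁶ + 6t⁵ + 8t⁴ + 2t³ - 5t² - 5t - 1 - 2a) = 5t⁴ + 14t³ + 19t² + 10t - 3. -/
theorem stmt_11 : ¬ ∃ t a : ℤ, 2 ≤ t ∧ 0 ≤ a ∧
    (2 * t ^ 6 + 6 * t ^ 5 + 8 * t ^ 4 + 2 * t ^ 3 - 5 * t ^ 2 - 5 * t - 1 + 2 * a) *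
        (2 * t ^ 6 + 6 * t ^ 5 + 8 * t ^ 4 + 2 * t ^ 3 - 5 * t ^ 2 - 5 * t - 1 - 2 * a) =
      5 * t ^ 4 + 14 * t ^ 3 + 19 * t ^ 2 + 10 * t - 3 := by
  rintro ⟨t, a, ht, ha, h⟩
  obtain ⟨s, rfl⟩ : ∃ s, t = s + 2 := ⟨t - 2, by ring⟩
  have hs : 0 ≤ s := by linarith
  have hR : 0 < 5 * (s+2) ^ 4 + 14 * (s+2) ^ 3 + 19 * (s+2) ^ 2 + 10 * (s+2) - 3 := by
    ring_nf; positivity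
  have hGR : 0 < (2 * (s+2) ^ 6 + 6 * (s+2) ^ 5 + 8 * (s+2) ^ 4 + 2 * (s+2) ^ 3
      - 5 * (s+2) ^ 2 - 5 * (s+2) - 1)
      - (5 * (s+2) ^ 4 + 14 * (s+2) ^ 3 + 19 * (s+2) ^ 2 + 10 * (s+2) - 3) := by
    ring_nf; positivity
  generalize 5 * (s+2) ^ 4 + 14 * (s+2) ^ 3 + 19 * (s+2) ^ 2 + 10 * (s+2) - 3 = R at *
  generalize 2 * (s+2) ^ 6 + 6 * (s+2) ^ 5 + 8 * (s+2) ^ 4 + 2 * (s+2) ^ 3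
      - 5 * (s+2) ^ 2 - 5 * (s+2) - 1 = G at *
  have h1 : 0 < G + 2 * a := by linarith
  have h2 : 0 < G - 2 * a := by
    rw [← h] at hR
    exact pos_of_mul_pos_right hR h1.le
  have h3 : 1 ≤ G - 2 * a := h2
  nlinarith [mul_le_mul_of_nonneg_left h3 h1.le]
end

section
/- For every integer t ≥ 2, the number t¹² - 6t¹¹ + 17t¹⁰ - 26t⁹ + 17t⁸ + 12t⁷ - 35t⁶ + 28t⁵ - 4t⁴ - 8t³ + 4t² + 1 is not a perfect square; that is, there is no integer a whose square equals this value. -/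
theorem stmt_12 (t : ℤ) (ht : 2 ≤ t) :
    ¬ ∃ a : ℤ, a ^ 2 = t ^ 12 - 6 * t ^ 11 + 17 * t ^ 10 - 26 * t ^ 9 + 17 * t ^ 8 +
      12 * t ^ 7 - 35 * t ^ 6 + 28 * t ^ 5 - 4 * t ^ 4 - 8 * t ^ 3 + 4 * t ^ 2 + 1 := by
  rintro ⟨a, ha⟩
  obtain ⟨s, hs, rfl⟩ : ∃ s : ℤ, 0 ≤ s ∧ t = s + 2 := ⟨t - 2, by omega, by ring⟩
  obtain ⟨R, hR⟩ : ∃ R : ℤ, R = 2 * (s + 2) ^ 6 - 6 * (s + 2) ^ 5 + 8 * (s + 2) ^ 4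
    - 2 * (s + 2) ^ 3 - 5 * (s + 2) ^ 2 + 5 * (s + 2) - 1 := ⟨_, rfl⟩
  have key : (2 * a) ^ 2 = R ^ 2 - (5 * (s + 2) ^ 4 - 14 * (s + 2) ^ 3 + 19 * (s + 2) ^ 2
      - 10 * (s + 2) - 3) := by
    rw [mul_pow, ha, hR]; ring
  have h1 : 0 < 5 * (s + 2) ^ 4 - 14 * (s + 2) ^ 3 + 19 * (s + 2) ^ 2
      - 10 * (s + 2) - 3 := by
    ring_nf; positivity
  have h2 : 0 < 2 * R - 1 - (5 * (s + 2) ^ 4 - 14 * (s + 2) ^ 3 + 19 * (s + 2) ^ 2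
      - 10 * (s + 2) - 3) := by
    rw [hR]; ring_nf; positivity
  have hR1 : 1 ≤ R := by linarith
  have u1 : |2 * a| < R := abs_lt_of_sq_lt_sq (by linarith) (by linarith)
  have u2 : R - 1 < |2 * a| := by
    apply lt_abs.2
    by_contra hc
    push Not at hc
    nlinarith [hc.1, hc.2]
  omega
end
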